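/- arXiv:math/0512265 — 4 statements merged into one kernel-verified Lean document; each statement's English description precedes it below -/
import Mathlib

section
/- Let M be a ⋆-monoid and let λ : M → ℂ satisfy λ 1 = 0, λ (star b) = conj (λ b) for all b ∈ M, and be conditionally positive definite. Then for every real t ≥ 0 the function b ↦ Complex.exp (t • λ b) is positive definite on M; that is, for every finitely supported κ : M → ℂ the sum ∑_{a,c} κ a * conj (κ c) * exp (t • λ (a * star c)) is a nonnegative real number. (This is the core of Theorem 1, (ii) ⇒ (i): the exponential of a conditionally positive-definite functional is an infinitely divisible positive-definite generating functional.) -/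
open Finset ComplexOrder

theorem aux_psd {M : Type*} [Monoid M] [StarMul M] (l : M → ℂ)
    (hunit : l 1 = 0)
    (hherm : ∀ b : M, l (star b) = (starRingEnd ℂ) (l b))
    (hcpd : ∀ κ : M →₀ ℂ, (∑ b ∈ κ.support, κ b) = 0 →
      0 ≤ ∑ a ∈ κ.support, ∑ c ∈ κ.support,
            κ a * (starRingEnd ℂ) (κ c) * l (a * star c)) :
    Matrix.PosSemidef (Matrix.of fun c a : M => l (a * star c) - l a - l (star c)) := by
  constructor
  · ext i j
    simp only [Matrix.conjTranspose_apply, Matrix.of_apply, star_sub]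
    have h1 := hherm (i * star j)
    have h2 := hherm j
    have h3 := hherm i
    simp only [star_mul, star_star] at h1
    simp only [RCLike.star_def, h1, h2, h3, map_sub, Complex.conj_conj]
    ring
  · intro κ
    set s : ℂ := κ.sum fun _ x => x with hs
    have h := hcpd (κ - Finsupp.single 1 s) (by
      change (κ - Finsupp.single 1 s).sum (fun _ x => x) = 0
      rw [Finsupp.sum_sub_index (by simp), Finsupp.sum_single_index rfl, hs, sub_self])
    change 0 ≤ (κ - Finsupp.single 1 s).sum (fun a x => (κ - Finsupp.single 1 s).sum
      fun c y => x * (starRingEnd ℂ) y * l (a * star c)) at h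
    have hin : ∀ (a : M) (x : ℂ), ((κ - Finsupp.single 1 s).sum
        fun c y => x * (starRingEnd ℂ) y * l (a * star c)) =
        (κ.sum fun c y => x * (starRingEnd ℂ) y * l (a * star c)) -
          x * (starRingEnd ℂ) s * l a := by
      intro a x
      rw [Finsupp.sum_sub_index (by intros; simp; ring), Finsupp.sum_single_index (by simp)]
      simp
    simp only [hin] at h
    rw [Finsupp.sum_sub_index, Finsupp.sum_single_index (by simp)] at h
    · refine h.trans_eq ?_
      simp only [Finsupp.sum, hunit, one_mul, mul_zero, sub_zero, Matrix.of_apply, RCLike.star_def,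
        sum_sub_distrib, mul_sub, sub_mul] at hs ⊢
      rw [Finset.sum_comm, hs, sub_sub, sub_sub]
      congr 1
      · refine Finset.sum_congr rfl fun a _ => Finset.sum_congr rfl fun c _ => by ring
      · congr 1
        · rw [Finset.sum_comm]
          refine Finset.sum_congr rfl fun a _ => ?_
          rw [map_sum, Finset.mul_sum, Finset.sum_mul]
          refine Finset.sum_congr rfl fun c _ => by ring
        · refine Finset.sum_congr rfl fun a _ => ?_
          rw [Finset.sum_mul, Finset.sum_mul]
          refine Finset.sum_congr rfl fun c _ => by ring
    · intro a x y
      simp only [Finsupp.sum, sub_mul, sum_sub_distrib]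
      ring

theorem aux_exp {M : Type*} (A : Matrix M M ℂ) (hA : A.PosSemidef) :
    Matrix.PosSemidef (Matrix.of fun i j => Complex.exp (A i j)) := by
  have hpow : ∀ n : ℕ, Matrix.PosSemidef (Matrix.of fun i j => A i j ^ n) := by
    intro n
    induction n with
    | zero =>
      constructor
      · ext i j; simp
      · intro x
        have : (x.sum fun i xi => x.sum fun j xj => star xi *
            (Matrix.of fun i j => A i j ^ 0) i j * xj) =
            star (∑ i ∈ x.support, x i) * (∑ i ∈ x.support, x i) := by
          simp [Finsupp.sum, Finset.sum_mul_sum]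
        rw [this]
        exact star_mul_self_nonneg _
    | succ n ih =>
      have := ih.hadamard hA
      have e : (Matrix.of fun i j => A i j ^ (n + 1)) =
          (Matrix.of fun i j => A i j ^ n).hadamard A := by
        ext i j
        simp [Matrix.hadamard_apply, pow_succ]
      rw [e]
      exact this
  constructor
  · ext i j
    have := congrFun (congrFun hA.1 i) j
    simp only [Matrix.conjTranspose_apply, Matrix.of_apply] at this ⊢
    rw [← this, RCLike.star_def, Complex.exp_conj]
  · intro x
    have ht : Filter.Tendsto (fun N : ℕ => x.sum fun i xi => x.sum fun j xj => star xi *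
        (∑ n ∈ Finset.range N, A i j ^ n / (n.factorial : ℂ)) * xj) Filter.atTop
        (nhds (x.sum fun i xi => x.sum fun j xj => star xi * Complex.exp (A i j) * xj)) := by
      simp only [Finsupp.sum]
      refine tendsto_finsetSum _ fun i _ => tendsto_finsetSum _ fun j _ => ?_
      refine Filter.Tendsto.mul_const _ (Filter.Tendsto.const_mul _ ?_)
      rw [Complex.exp_eq_exp_ℂ]
      exact (NormedSpace.expSeries_div_hasSum_exp (A i j)).tendsto_sum_nat
    refine ge_of_tendsto' ht fun N => ?_
    have hN : Matrix.PosSemidef (∑ n ∈ Finset.range N,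
        ((n.factorial : ℝ)⁻¹ : ℝ) • (Matrix.of fun i j => A i j ^ n)) :=
      Matrix.posSemidef_sum _ fun n _ => (hpow n).smul (by positivity)
    have := hN.2 x
    refine this.trans_eq ?_
    simp only [Finsupp.sum]
    refine Finset.sum_congr rfl fun i _ => Finset.sum_congr rfl fun j _ => ?_
    congr 2
    simp [Matrix.sum_apply, div_eq_inv_mul]

/-- The core of Theorem 1, (ii) ⇒ (i): if `l : M → ℂ` on a ⋆-monoid `M` vanishes at the unit,
is ⋆-Hermitian and conditionally positive definite, then for every `t ≥ 0` the function
`b ↦ exp (t • l b)` is positive definite on `M`. -/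
theorem exp_of_condPosDef_isPosDef {M : Type*} [Monoid M] [StarMul M] (l : M → ℂ)
    (hunit : l 1 = 0)
    (hherm : ∀ b : M, l (star b) = (starRingEnd ℂ) (l b))
    (hcpd : ∀ κ : M →₀ ℂ, (∑ b ∈ κ.support, κ b) = 0 →
      0 ≤ ∑ a ∈ κ.support, ∑ c ∈ κ.support,
            κ a * (starRingEnd ℂ) (κ c) * l (a * star c)) :
    ∀ t : ℝ, 0 ≤ t → ∀ κ : M →₀ ℂ,
      0 ≤ ∑ a ∈ κ.support, ∑ c ∈ κ.support,
            κ a * (starRingEnd ℂ) (κ c) * Complex.exp (t • l (a * star c)) := by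
  intro t ht κ
  have h := (aux_exp _ ((aux_psd l hunit hherm hcpd).smul ht)).2
    (Finsupp.onFinset κ.support (fun a => κ a * Complex.exp (t • l a)) (by
      intro a ha
      rw [Finsupp.mem_support_iff]
      exact left_ne_zero_of_mul ha))
  have hsupp : (Finsupp.onFinset κ.support (fun a => κ a * Complex.exp (t • l a)) (by
      intro a ha
      rw [Finsupp.mem_support_iff]
      exact left_ne_zero_of_mul ha)).support = κ.support := by
    ext a
    simp [Complex.exp_ne_zero]
  simp only [Finsupp.sum, hsupp] at h
  rw [Finset.sum_comm] at h
  refine h.trans_eq ?_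
  refine Finset.sum_congr rfl fun a _ => Finset.sum_congr rfl fun c _ => ?_
  have e : Complex.exp (t • l (a * star c)) = Complex.exp (t • (starRingEnd ℂ) (l c)) *
      Complex.exp (t • (l (a * star c) - l a - l (star c))) * Complex.exp (t • l a) := by
    rw [← Complex.exp_add, ← Complex.exp_add, hherm c]
    congr 1
    simp only [Complex.real_smul]
    ring
  rw [e]
  simp only [Finsupp.onFinset_apply, Matrix.smul_apply, Matrix.of_apply, RCLike.star_def, map_mul,
    ← Complex.exp_conj, Complex.real_smul, Complex.conj_ofReal]
  ring
end

section
/- Let M be a ⋆-monoid and let λ : M → ℂ satisfy λ 1 = 0, λ (star b) = conj (λ b) for all b ∈ M, and be conditionally positive definite. Then the shifted kernel (a, c) ↦ λ (a * star c) − λ a − conj (λ c) is positive definite without any constraint on κ: for every finitely supported κ : M → ℂ, the sum ∑_{a,c} κ a * conj (κ c) * (λ (a * star c) − λ a − conj (λ c)) is a nonnegative real number. (This is the key step in the proof of Theorem 1, producing the Gelfand–Naimark–Segal-type inner product of the cocycle k from the conditionally positive functional λ.) -/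
open Finset ComplexOrder

/-- The key step in the proof of Theorem 1: if `l : M → ℂ` on a ⋆-monoid `M` vanishes at the
unit, is ⋆-Hermitian and conditionally positive definite, then the shifted kernel
`(a, c) ↦ l (a * star c) - l a - conj (l c)` is positive definite without any constraint
on the finitely supported weights. -/
theorem shifted_kernel_posDef {M : Type*} [Monoid M] [StarMul M] (l : M → ℂ)
    (hunit : l 1 = 0)
    (hherm : ∀ b : M, l (star b) = (starRingEnd ℂ) (l b))
    (hcpd : ∀ κ : M →₀ ℂ, (∑ b ∈ κ.support, κ b) = 0 →
      0 ≤ ∑ a ∈ κ.support, ∑ c ∈ κ.support,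
            κ a * (starRingEnd ℂ) (κ c) * l (a * star c)) :
    ∀ κ : M →₀ ℂ,
      0 ≤ ∑ a ∈ κ.support, ∑ c ∈ κ.support,
            κ a * (starRingEnd ℂ) (κ c) *
              (l (a * star c) - l a - (starRingEnd ℂ) (l c)) := by
  classical
  intro κ
  obtain ⟨T, hT⟩ : ∃ T, T = insert (1 : M) κ.support := ⟨_, rfl⟩
  have h1T : (1 : M) ∈ T := by simp [hT]
  have hκT : κ.support ⊆ T := by simp [hT]
  have key : ∀ (μ : M →₀ ℂ), μ.support ⊆ T → ∀ K : M → M → ℂ,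
      ∑ a ∈ μ.support, ∑ c ∈ μ.support, μ a * (starRingEnd ℂ) (μ c) * K a c
        = ∑ a ∈ T, μ a * ∑ c ∈ T, (starRingEnd ℂ) (μ c) * K a c := by
    intro μ hμ K
    rw [← Finset.sum_subset hμ]
    · refine Finset.sum_congr rfl fun a _ => ?_
      rw [← Finset.sum_subset hμ, Finset.mul_sum]
      · simp only [mul_assoc]
      · intro c _ hc
        simp [Finsupp.notMem_support_iff.mp hc]
    · intro c _ hc
      simp [Finsupp.notMem_support_iff.mp hc]
  obtain ⟨s, hs⟩ : ∃ s, s = ∑ a ∈ T, κ a := ⟨_, rfl⟩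
  obtain ⟨μ, hμ⟩ : ∃ μ : M →₀ ℂ, μ = κ - Finsupp.single 1 s := ⟨_, rfl⟩
  have hμa : ∀ a, μ a = κ a - if a = 1 then s else 0 := by
    intro a
    simp [hμ, Finsupp.single_apply, eq_comm]
  have hμT : μ.support ⊆ T := by
    intro a ha
    by_contra h
    have h1 : a ≠ 1 := fun e => h (e ▸ h1T)
    have h2 : κ a = 0 := Finsupp.notMem_support_iff.mp fun e => h (hκT e)
    exact Finsupp.mem_support_iff.mp ha (by simp [hμa, h1, h2])
  have h0 : ∑ b ∈ μ.support, μ b = 0 := by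
    rw [Finset.sum_subset hμT (fun c _ hc => Finsupp.notMem_support_iff.mp hc)]
    simp [hμa, Finset.sum_sub_distrib, h1T, ← hs]
  have h := hcpd μ h0
  rw [key μ hμT (fun a c => l (a * star c))] at h
  rw [key κ hκT (fun a c => l (a * star c) - l a - (starRingEnd ℂ) (l c))]
  convert h using 1
  have hsc : (starRingEnd ℂ) s = ∑ a ∈ T, (starRingEnd ℂ) (κ a) := by rw [hs, map_sum]
  have inner : ∀ a, ∑ c ∈ T, (starRingEnd ℂ) (μ c) * l (a * star c)
      = ∑ c ∈ T, (starRingEnd ℂ) (κ c) * l (a * star c) - (starRingEnd ℂ) s * l a := by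
    intro a
    simp only [hμa, map_sub, sub_mul, Finset.sum_sub_distrib, apply_ite (starRingEnd ℂ), map_zero,
      ite_mul, zero_mul, Finset.sum_ite_eq', h1T, if_true, star_one, mul_one]
  have inner2 : ∀ a, ∑ c ∈ T, (starRingEnd ℂ) (κ c) * (l (a * star c) - l a - (starRingEnd ℂ) (l c))
      = ∑ c ∈ T, (starRingEnd ℂ) (κ c) * l (a * star c) - (starRingEnd ℂ) s * l a
        - ∑ c ∈ T, (starRingEnd ℂ) (κ c) * (starRingEnd ℂ) (l c) := by
    intro a
    simp only [mul_sub, Finset.sum_sub_distrib, hsc, Finset.sum_mul]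
  have outer : ∀ F : M → ℂ, ∑ a ∈ T, μ a * F a = ∑ a ∈ T, κ a * F a - s * F 1 := by
    intro F
    simp only [hμa, sub_mul, Finset.sum_sub_distrib, ite_mul, zero_mul, Finset.sum_ite_eq', h1T,
      if_true]
  rw [outer]
  simp only [inner, inner2]
  simp only [one_mul, hunit, hherm, mul_zero, sub_zero]
  rw [Finset.sum_congr rfl fun a _ => mul_sub (κ a) _ _, Finset.sum_sub_distrib,
    ← Finset.sum_mul, ← hs]
end

section
/- Let M be a ⋆-monoid and λ : M → ℂ a function with λ 1 = 0. Assume that for every real t > 0 the function b ↦ Complex.exp (t • λ b) is positive definite on M. Then λ is conditionally positive definite: for every finitely supported κ : M → ℂ with ∑_b κ b = 0, the sum ∑_{a,c} κ a * conj (κ c) * λ (a * star c) is a nonnegative real number. (This is the differentiation-at-t=0 step of Theorem 1, (i) ⇒ (ii): the logarithmic derivative of an infinitely divisible family of positive-definite functions is conditionally positive definite.) -/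
open Finset ComplexOrder

/-- The differentiation-at-`t = 0` step of Theorem 1, (i) ⇒ (ii): if `l 1 = 0` and for every
`t > 0` the function `b ↦ exp (t • l b)` is positive definite on the ⋆-monoid `M`, then `l` is
conditionally positive definite. -/
theorem condPosDef_of_exp_posDef {M : Type*} [Monoid M] [StarMul M] (l : M → ℂ)
    (hunit : l 1 = 0)
    (hexp : ∀ t : ℝ, 0 < t → ∀ κ : M →₀ ℂ,
      0 ≤ ∑ a ∈ κ.support, ∑ c ∈ κ.support,
            κ a * (starRingEnd ℂ) (κ c) * Complex.exp (t • l (a * star c))) :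
    ∀ κ : M →₀ ℂ, (∑ b ∈ κ.support, κ b) = 0 →
      0 ≤ ∑ a ∈ κ.support, ∑ c ∈ κ.support,
            κ a * (starRingEnd ℂ) (κ c) * l (a * star c) := by
  intro κ hκ
  have hF : HasDerivAt (fun t : ℝ => ∑ a ∈ κ.support, ∑ c ∈ κ.support,
      κ a * (starRingEnd ℂ) (κ c) * Complex.exp (t • l (a * star c)))
      (∑ a ∈ κ.support, ∑ c ∈ κ.support, κ a * (starRingEnd ℂ) (κ c) * l (a * star c)) 0 := by
    refine HasDerivAt.fun_sum fun a _ => HasDerivAt.fun_sum fun c _ => ?_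
    refine HasDerivAt.const_mul _ ?_
    have h1 : HasDerivAt (fun t : ℝ => t • l (a * star c)) (l (a * star c)) 0 := by
      simpa using (hasDerivAt_id (0 : ℝ)).smul_const (l (a * star c))
    simpa using h1.cexp
  have h0 : ∑ a ∈ κ.support, ∑ c ∈ κ.support,
      κ a * (starRingEnd ℂ) (κ c) * Complex.exp ((0 : ℝ) • l (a * star c)) = 0 := by
    simp only [zero_smul, Complex.exp_zero, mul_one]
    rw [← Finset.sum_mul_sum, hκ, zero_mul]
  have ht := hF.tendsto_slope_zero_right
  refine ge_of_tendsto ht ?_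
  filter_upwards [self_mem_nhdsWithin] with t ht
  have ht' : (0 : ℝ) < t := ht
  rw [h0, sub_zero]
  simp only [zero_add]
  exact smul_nonneg (inv_nonneg.mpr ht'.le) (hexp t ht' κ)
end

section
/- Let M be a monoid, K a complex vector space, and suppose given maps j : M → (K →ₗ[ℂ] K), k : M → K, k' : M → (K →ₗ[ℂ] ℂ) and l : M → ℂ. For each b ∈ M define the linear map 𝐣(b) on ℂ × K × ℂ by 𝐣(b)(x, v, y) := (x + k'(b) v + l(b) * y, j(b) v + y • k(b), y). Then 𝐣(a * c) = 𝐣(a) ∘ 𝐣(c) holds for all a, c ∈ M if and only if for all a, c ∈ M: (1) j(a * c) = j(a) ∘ j(c); (2) k(a * c) = j(a) (k c) + k a (k is a j-cocycle); (3) k'(a * c) = k' c + (k' a) ∘ j(c); and (4) l(a * c) = l a + l c + k'(a) (k c). (This is the multiplicativity of the canonical block-triangular representation of the monoid in the complex Minkowski space ℂ ⊕ K ⊕ ℂ, underlying part (iv) of Theorem 1.) -/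
/-- The canonical block-triangular map `𝐣(b)` on `ℂ × K × ℂ` determined by the data
`(l b, k' b, k b, j b)`:  `𝐣(b)(x, v, y) = (x + k'(b) v + l(b)·y, j(b) v + y • k(b), y)`. -/
def triRep {M K : Type*} [AddCommGroup K] [Module ℂ K]
    (j : M → (K →ₗ[ℂ] K)) (k : M → K) (k' : M → (K →ₗ[ℂ] ℂ)) (l : M → ℂ)
    (b : M) : ℂ × K × ℂ → ℂ × K × ℂ :=
  fun p => (p.1 + k' b p.2.1 + l b * p.2.2, j b p.2.1 + p.2.2 • k b, p.2.2)

/-- Multiplicativity of the canonical triangular representation `𝐣` of a monoid `M` in the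
complex Minkowski space `ℂ ⊕ K ⊕ ℂ` is equivalent to: `j` is multiplicative, `k` is a
`j`-cocycle, `k'` is a dual cocycle, and `l(a·c) = l a + l c + k'(a)(k c)`. -/
theorem triRep_mul_iff {M : Type*} [Monoid M] {K : Type*} [AddCommGroup K] [Module ℂ K]
    (j : M → (K →ₗ[ℂ] K)) (k : M → K) (k' : M → (K →ₗ[ℂ] ℂ)) (l : M → ℂ) :
    (∀ a c : M, triRep j k k' l (a * c) = triRep j k k' l a ∘ triRep j k k' l c) ↔
      ((∀ a c : M, j (a * c) = (j a).comp (j c)) ∧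
       (∀ a c : M, k (a * c) = j a (k c) + k a) ∧
       (∀ a c : M, k' (a * c) = k' c + (k' a).comp (j c)) ∧
       (∀ a c : M, l (a * c) = l a + l c + k' a (k c))) := by
  constructor
  · intro h
    refine ⟨fun a c => ?_, fun a c => ?_, fun a c => ?_, fun a c => ?_⟩
    · ext v
      have := congrArg (fun p => p.2.1) (congrFun (h a c) (0, v, 0))
      simpa [triRep] using this
    · have := congrArg (fun p => p.2.1) (congrFun (h a c) (0, 0, 1))
      simpa [triRep] using this
    · ext v
      have := congrArg (fun p => p.1) (congrFun (h a c) (0, v, 0))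
      simpa [triRep] using this
    · have := congrArg (fun p => p.1) (congrFun (h a c) (0, 0, 1))
      simp [triRep] at this
      rw [this]; ring
  · rintro ⟨h1, h2, h3, h4⟩ a c
    funext ⟨x, v, y⟩
    simp only [triRep, Function.comp, h1, h2, h3, h4, Prod.mk.injEq, LinearMap.comp_apply,
      LinearMap.add_apply, map_add, map_smul, smul_add, smul_eq_mul, and_true]
    constructor
    · ring
    · abel
end
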